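/- A skew left brace A belongs to the class I₂ if and only if v*u = 1 for all u ∈ Ann₂(A) and all v ∈ Γ₂(A). -/

import Mathlib

set_option linter.unusedVariables false

universe u v

/-- A skew left brace: a carrier with two group structures `(A,·)` (written `dmul`) and
`(A,∘)` (written `cmul`) sharing the same identity `ident`, satisfying
`a ∘ (b · c) = (a ∘ b) · a⁻¹ · (a ∘ c)`. -/
class SkewBrace (A : Type u) where
  dmul : A → A → A
  ident : A
  dinv : A → A
  cmul : A → A → A
  cinv : A → A
  dmul_assoc : ∀ a b c : A, dmul (dmul a b) c = dmul a (dmul b c)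
  ident_dmul : ∀ a : A, dmul ident a = a
  dmul_ident : ∀ a : A, dmul a ident = a
  dinv_dmul : ∀ a : A, dmul (dinv a) a = ident
  dmul_dinv : ∀ a : A, dmul a (dinv a) = ident
  cmul_assoc : ∀ a b c : A, cmul (cmul a b) c = cmul a (cmul b c)
  ident_cmul : ∀ a : A, cmul ident a = a
  cmul_ident : ∀ a : A, cmul a ident = a
  cinv_cmul : ∀ a : A, cmul (cinv a) a = ident
  cmul_cinv : ∀ a : A, cmul a (cinv a) = ident
  compat : ∀ a b c : A, cmul a (dmul b c) = dmul (dmul (cmul a b) (dinv a)) (cmul a c)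

namespace SkewBrace

variable {A : Type u} [SkewBrace A]

/-- The lambda map `λ_a(b) = a⁻¹ · (a ∘ b)`. -/
def lam (a b : A) : A := dmul (dinv a) (cmul a b)

/-- The star operation `a * b = λ_a(b) · b⁻¹`. -/
def bstar (a b : A) : A := dmul (lam a b) (dinv b)

/-- The dot commutator `[a,b]· = a · b · a⁻¹ · b⁻¹`. -/
def dcomm (a b : A) : A := dmul (dmul (dmul a b) (dinv a)) (dinv b)

/-- The circle commutator `[a,b]∘ = a ∘ b ∘ ā ∘ b̄`. -/
def ccomm (a b : A) : A := cmul (cmul (cmul a b) (cinv a)) (cinv b)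

/-- Membership in the subgroup of `(A,·)` generated by a subset. -/
inductive dclosure (S : Set A) : A → Prop
  | mem {x : A} : x ∈ S → dclosure S x
  | one : dclosure S ident
  | mul {x y : A} : dclosure S x → dclosure S y → dclosure S (dmul x y)
  | inv {x : A} : dclosure S x → dclosure S (dinv x)

/-- The subgroup of `(A,·)` generated by a subset, as a set. -/
def dcl (S : Set A) : Set A := {x | dclosure S x}

/-- Membership in the subgroup of `(A,∘)` generated by a subset. -/
inductive cclosure (S : Set A) : A → Prop
  | mem {x : A} : x ∈ S → cclosure S x
  | one : cclosure S ident
  | mul {x y : A} : cclosure S x → cclosure S y → cclosure S (cmul x y)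
  | inv {x : A} : cclosure S x → cclosure S (cinv x)

/-- The subgroup of `(A,∘)` generated by a subset, as a set. -/
def ccl (S : Set A) : Set A := {x | cclosure S x}

/-- The set `{x * y : x ∈ I, y ∈ J}` (star values). -/
def starSet (I J : Set A) : Set A := {x | ∃ a ∈ I, ∃ b ∈ J, x = bstar a b}

/-- The set of dot commutators `[a,b]·` with `a ∈ I`, `b ∈ J`. -/
def dcommSet (I J : Set A) : Set A := {x | ∃ a ∈ I, ∃ b ∈ J, x = dcomm a b}

/-- The set of circle commutators `[a,b]∘` with `a ∈ I`, `b ∈ J`. -/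
def ccommSet (I J : Set A) : Set A := {x | ∃ a ∈ I, ∃ b ∈ J, x = ccomm a b}

/-- The lower central series `Γ_n(A)` of the skew brace `A` (`Gamma A n = Γ_n(A)` for `n ≥ 1`):
`Γ₁(A) = A` and `Γ_n(A) = ⟨A * Γ_{n-1}(A), Γ_{n-1}(A) * A, [A,Γ_{n-1}(A)]·⟩·`. -/
def Gamma (A : Type u) [SkewBrace A] : ℕ → Set A
  | 0 => Set.univ
  | 1 => Set.univ
  | (n+2) =>
      dcl (starSet Set.univ (Gamma A (n+1)) ∪ starSet (Gamma A (n+1)) Set.univ ∪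
        dcommSet Set.univ (Gamma A (n+1)))

/-- The lower central series `γ_n(A,∘)` of the group `(A,∘)`
(`gammaCirc A n = γ_n(A,∘)` for `n ≥ 1`). -/
def gammaCirc (A : Type u) [SkewBrace A] : ℕ → Set A
  | 0 => Set.univ
  | 1 => Set.univ
  | (n+2) => ccl (ccommSet (gammaCirc A (n+1)) Set.univ)

/-- The series `Γ̄_n(A)`: `Γ̄₁(A) = A`, `Γ̄_n(A) = ⟨A * Γ̄_{n-1}(A), [A, Γ̄_{n-1}(A)]·⟩·`. -/
def GammaBar (A : Type u) [SkewBrace A] : ℕ → Set A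
  | 0 => Set.univ
  | 1 => Set.univ
  | (n+2) =>
      dcl (starSet Set.univ (GammaBar A (n+1)) ∪ dcommSet Set.univ (GammaBar A (n+1)))

/-- The annihilator series: `AnnS A n = Ann_n(A)`, with `Ann_0(A) = 1` and
`Ann_n(A) = {a | a*b, b*a, [a,b]· ∈ Ann_{n-1}(A) for all b}`. -/
def AnnS (A : Type u) [SkewBrace A] : ℕ → Set A
  | 0 => {ident}
  | (n+1) => {a | ∀ b : A, bstar a b ∈ AnnS A n ∧ bstar b a ∈ AnnS A n ∧ dcomm a b ∈ AnnS A n}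

/-- The alphabet `X = {γ·, γ̄·, *, *̄}` of brace commutator symbols. -/
inductive BWord : Type
  | g | gbar | s | sbar

/-- Evaluation of a single symbol of `X`. -/
def evalX : BWord → A → A → A
  | BWord.g => dcomm
  | BWord.gbar => fun a b => dcomm b a
  | BWord.s => bstar
  | BWord.sbar => fun a b => bstar b a

/-- `evalW e a n` is the value `m(a₀ a₁ ⋯ a_n)` of the degree-`n` brace commutator word
`m = (e 0)(e 1)⋯(e (n-1))` on the arguments `a 0, …, a n`:
`m(a₀ ⋯ a_n) = (e 0)(a₀, (e 1)(a₁, …, (e (n-1))(a_{n-1}, a_n)⋯))`. -/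
def evalW : (ℕ → BWord) → (ℕ → A) → ℕ → A
  | _, a, 0 => a 0
  | e, a, (n+1) => evalX (e 0) (a 0) (evalW (fun i => e (i+1)) (fun i => a (i+1)) n)

/-- `Asub A t = A_{(t)}`, the subgroup of `(A,·)` generated by all values of brace commutator
words of degree `≥ t`. -/
def Asub (A : Type u) [SkewBrace A] (t : ℕ) : Set A :=
  dcl {x | ∃ s : ℕ, t ≤ s ∧ ∃ (e : ℕ → BWord) (a : ℕ → A), x = evalW e a s}

/-- `Sset A r = S_r(A)`, the set of all values of brace commutator words of degree exactly `r`
(`S_0(A) = A`). -/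
def Sset (A : Type u) [SkewBrace A] (r : ℕ) : Set A :=
  {x | ∃ (e : ℕ → BWord) (a : ℕ → A), x = evalW e a r}

/-- `cosetRel I a b` says that `b` lies in the coset `I · a`. -/
def cosetRel (I : Set A) (a b : A) : Prop := ∃ c ∈ I, b = dmul c a

/-- The class `I_n`: the maps `φ_m : (A/Ann_n(A))^{n+1} → A_{(n)}`,
`(Ann_n(A)a₁, …, Ann_n(A)a_{n+1}) ↦ m(a₁⋯a_{n+1})`, are well defined for every word `m` of
degree `n`. -/
def InClass (A : Type u) [SkewBrace A] (n : ℕ) : Prop :=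
  ∀ (e : ℕ → BWord) (a b : ℕ → A),
    (∀ i : ℕ, i ≤ n → cosetRel (AnnS A n) (a i) (b i)) →
    evalW e b n = evalW e a n

/-- A skew left brace `(A,·,∘)` is symmetric if `(A,∘,·)` is also a skew left brace, i.e.
`a · (b ∘ c) = (a · b) ∘ ā ∘ (a · c)`. -/
def IsSymmetric (A : Type u) [SkewBrace A] : Prop :=
  ∀ a b c : A, dmul a (cmul b c) = cmul (cmul (dmul a b) (cinv a)) (dmul a c)

/-- A sub-skew brace: a subset which is a subgroup of both `(A,·)` and `(A,∘)`. -/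
structure IsSubBrace (A : Type u) [SkewBrace A] (S : Set A) : Prop where
  ident_mem : ident ∈ S
  dmul_mem : ∀ {x y : A}, x ∈ S → y ∈ S → dmul x y ∈ S
  dinv_mem : ∀ {x : A}, x ∈ S → dinv x ∈ S
  cmul_mem : ∀ {x y : A}, x ∈ S → y ∈ S → cmul x y ∈ S
  cinv_mem : ∀ {x : A}, x ∈ S → cinv x ∈ S

/-- An ideal of a skew brace: a subgroup of `(A,·)`, normal in `(A,·)` and `(A,∘)`,
and invariant under all `λ_a`. -/
structure IsIdeal (A : Type u) [SkewBrace A] (I : Set A) : Prop where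
  ident_mem : ident ∈ I
  dmul_mem : ∀ {x y : A}, x ∈ I → y ∈ I → dmul x y ∈ I
  dinv_mem : ∀ {x : A}, x ∈ I → dinv x ∈ I
  dconj_mem : ∀ (a : A) {x : A}, x ∈ I → dmul (dmul a x) (dinv a) ∈ I
  cconj_mem : ∀ (a : A) {x : A}, x ∈ I → cmul (cmul a x) (cinv a) ∈ I
  lam_mem : ∀ (a : A) {x : A}, x ∈ I → lam a x ∈ I

/-- A homomorphism of skew braces. -/
structure IsBraceHom {A : Type u} {B : Type v} [SkewBrace A] [SkewBrace B] (f : A → B) : Prop where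
  map_dmul : ∀ x y : A, f (dmul x y) = dmul (f x) (f y)
  map_cmul : ∀ x y : A, f (cmul x y) = cmul (f x) (f y)

/-- The data of an isoclinism of skew braces along ideals `I` of `A` and `J` of `B`:
`ξ` induces a brace isomorphism `A/I → B/J` and `θ` restricts to a brace isomorphism
`Γ₂(A) → Γ₂(B)` compatible with the commutator and star maps. -/
structure IsoclinismData (A : Type u) (B : Type v) [SkewBrace A] [SkewBrace B]
    (I : Set A) (J : Set B) (ξ θ : A → B) : Prop where
  xi_resp : ∀ a a' : A, cosetRel I a a' ↔ cosetRel J (ξ a) (ξ a')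
  xi_surj : ∀ b : B, ∃ a : A, cosetRel J b (ξ a)
  xi_dmul : ∀ a a' : A, cosetRel J (dmul (ξ a) (ξ a')) (ξ (dmul a a'))
  xi_cmul : ∀ a a' : A, cosetRel J (cmul (ξ a) (ξ a')) (ξ (cmul a a'))
  theta_maps : ∀ x ∈ Gamma A 2, θ x ∈ Gamma B 2
  theta_inj : ∀ x ∈ Gamma A 2, ∀ y ∈ Gamma A 2, θ x = θ y → x = y
  theta_surj : ∀ y ∈ Gamma B 2, ∃ x ∈ Gamma A 2, θ x = y
  theta_dmul : ∀ x ∈ Gamma A 2, ∀ y ∈ Gamma A 2, θ (dmul x y) = dmul (θ x) (θ y)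
  theta_cmul : ∀ x ∈ Gamma A 2, ∀ y ∈ Gamma A 2, θ (cmul x y) = cmul (θ x) (θ y)
  compat_dcomm : ∀ a₁ a₂ : A, ∀ b₁ b₂ : B, cosetRel J b₁ (ξ a₁) → cosetRel J b₂ (ξ a₂) →
    θ (dcomm a₁ a₂) = dcomm b₁ b₂
  compat_star : ∀ a₁ a₂ : A, ∀ b₁ b₂ : B, cosetRel J b₁ (ξ a₁) → cosetRel J b₂ (ξ a₂) →
    θ (bstar a₁ a₂) = bstar b₁ b₂

/-- Isoclinism (1-isoclinism) of skew left braces. -/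
def Isoclinic (A : Type u) (B : Type v) [SkewBrace A] [SkewBrace B] : Prop :=
  ∃ ξ θ : A → B, IsoclinismData A B (AnnS A 1) (AnnS B 1) ξ θ

/-- The data of an `n`-isoclinism of skew braces: `ξ` induces a brace isomorphism
`A/Ann_n(A) → B/Ann_n(B)` and `θ` restricts to a brace isomorphism `A_{(n)} → B_{(n)}`
commuting with all brace commutator word maps of degree `n`. -/
structure IsoclinismDataN (A : Type u) (B : Type v) [SkewBrace A] [SkewBrace B]
    (n : ℕ) (ξ θ : A → B) : Prop where
  xi_resp : ∀ a a' : A, cosetRel (AnnS A n) a a' ↔ cosetRel (AnnS B n) (ξ a) (ξ a')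
  xi_surj : ∀ b : B, ∃ a : A, cosetRel (AnnS B n) b (ξ a)
  xi_dmul : ∀ a a' : A, cosetRel (AnnS B n) (dmul (ξ a) (ξ a')) (ξ (dmul a a'))
  xi_cmul : ∀ a a' : A, cosetRel (AnnS B n) (cmul (ξ a) (ξ a')) (ξ (cmul a a'))
  theta_maps : ∀ x ∈ Asub A n, θ x ∈ Asub B n
  theta_inj : ∀ x ∈ Asub A n, ∀ y ∈ Asub A n, θ x = θ y → x = y
  theta_surj : ∀ y ∈ Asub B n, ∃ x ∈ Asub A n, θ x = y
  theta_dmul : ∀ x ∈ Asub A n, ∀ y ∈ Asub A n, θ (dmul x y) = dmul (θ x) (θ y)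
  theta_cmul : ∀ x ∈ Asub A n, ∀ y ∈ Asub A n, θ (cmul x y) = cmul (θ x) (θ y)
  compat : ∀ (e : ℕ → BWord) (a : ℕ → A) (b : ℕ → B),
    (∀ i : ℕ, i ≤ n → cosetRel (AnnS B n) (b i) (ξ (a i))) →
    θ (evalW e a n) = evalW e b n

/-- `n`-isoclinism of skew left braces. -/
def IsoclinicN (A : Type u) (B : Type v) [SkewBrace A] [SkewBrace B] (n : ℕ) : Prop :=
  ∃ ξ θ : A → B, IsoclinismDataN A B n ξ θ

/-- The product set `S · T = {s · t : s ∈ S, t ∈ T}` in `(A,·)`. -/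
def setDProd (S T : Set A) : Set A := {x | ∃ s ∈ S, ∃ t ∈ T, x = dmul s t}

/-- The product set `S ∘ T = {s ∘ t : s ∈ S, t ∈ T}` in `(A,∘)`. -/
def setCProd (S T : Set A) : Set A := {x | ∃ s ∈ S, ∃ t ∈ T, x = cmul s t}

/-- The skew brace structure on a sub-skew brace. -/
def subBrace (S : Set A) (h : IsSubBrace A S) : SkewBrace S where
  dmul x y := ⟨dmul x.1 y.1, h.dmul_mem x.2 y.2⟩
  ident := ⟨ident, h.ident_mem⟩
  dinv x := ⟨dinv x.1, h.dinv_mem x.2⟩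
  cmul x y := ⟨cmul x.1 y.1, h.cmul_mem x.2 y.2⟩
  cinv x := ⟨cinv x.1, h.cinv_mem x.2⟩
  dmul_assoc a b c := Subtype.ext (dmul_assoc a.1 b.1 c.1)
  ident_dmul a := Subtype.ext (ident_dmul a.1)
  dmul_ident a := Subtype.ext (dmul_ident a.1)
  dinv_dmul a := Subtype.ext (dinv_dmul a.1)
  dmul_dinv a := Subtype.ext (dmul_dinv a.1)
  cmul_assoc a b c := Subtype.ext (cmul_assoc a.1 b.1 c.1)
  ident_cmul a := Subtype.ext (ident_cmul a.1)
  cmul_ident a := Subtype.ext (cmul_ident a.1)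
  cinv_cmul a := Subtype.ext (cinv_cmul a.1)
  cmul_cinv a := Subtype.ext (cmul_cinv a.1)
  compat a b c := Subtype.ext (compat a.1 b.1 c.1)

/-- The direct product of two skew braces, with componentwise operations. -/
instance prodBrace (A : Type u) (B : Type v) [SkewBrace A] [SkewBrace B] :
    SkewBrace (A × B) where
  dmul p q := (dmul p.1 q.1, dmul p.2 q.2)
  ident := (ident, ident)
  dinv p := (dinv p.1, dinv p.2)
  cmul p q := (cmul p.1 q.1, cmul p.2 q.2)
  cinv p := (cinv p.1, cinv p.2)
  dmul_assoc a b c := Prod.ext_iff.mpr ⟨dmul_assoc _ _ _, dmul_assoc _ _ _⟩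
  ident_dmul a := Prod.ext_iff.mpr ⟨ident_dmul _, ident_dmul _⟩
  dmul_ident a := Prod.ext_iff.mpr ⟨dmul_ident _, dmul_ident _⟩
  dinv_dmul a := Prod.ext_iff.mpr ⟨dinv_dmul _, dinv_dmul _⟩
  dmul_dinv a := Prod.ext_iff.mpr ⟨dmul_dinv _, dmul_dinv _⟩
  cmul_assoc a b c := Prod.ext_iff.mpr ⟨cmul_assoc _ _ _, cmul_assoc _ _ _⟩
  ident_cmul a := Prod.ext_iff.mpr ⟨ident_cmul _, ident_cmul _⟩
  cmul_ident a := Prod.ext_iff.mpr ⟨cmul_ident _, cmul_ident _⟩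
  cinv_cmul a := Prod.ext_iff.mpr ⟨cinv_cmul _, cinv_cmul _⟩
  cmul_cinv a := Prod.ext_iff.mpr ⟨cmul_cinv _, cmul_cinv _⟩
  compat a b c := Prod.ext_iff.mpr ⟨compat _ _ _, compat _ _ _⟩

end SkewBrace

namespace SkewBrace

section

variable {A : Type u} [SkewBrace A]

/-- The group `(A,·)` of a skew brace. -/
@[reducible] def dotGroup (A : Type u) [SkewBrace A] : Group A where
  mul := dmul
  one := ident
  inv := dinv
  mul_assoc := dmul_assoc
  one_mul := ident_dmul
  mul_one := dmul_ident
  inv_mul_cancel := dinv_dmul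

attribute [local instance] dotGroup

theorem lam_eq (a b : A) : lam a b = a⁻¹ * cmul a b := rfl

theorem bstar_eq (a b : A) : bstar a b = lam a b * b⁻¹ := rfl

theorem dcomm_eq (a b : A) : dcomm a b = a * b * a⁻¹ * b⁻¹ := rfl

theorem cmul_eq_mul_lam (a b : A) : cmul a b = a * lam a b := by simp [lam_eq]

theorem cmul_mul (a b c : A) : cmul a (b * c) = cmul a b * a⁻¹ * cmul a c := compat a b c

theorem lam_mul (a b c : A) : lam a (b * c) = lam a b * lam a c := by
  simp only [lam_eq, cmul_mul]; group

theorem lam_one (a : A) : lam a 1 = 1 := by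
  have h := lam_mul a 1 1
  rw [mul_one] at h
  exact left_eq_mul.mp h

theorem lam_inv (a b : A) : lam a b⁻¹ = (lam a b)⁻¹ := by
  rw [eq_inv_iff_mul_eq_one, ← lam_mul, inv_mul_cancel, lam_one]

theorem lam_cmul (a b c : A) : lam (cmul a b) c = lam a (lam b c) := by
  have h : cmul a (b * lam b c) = cmul a b * lam a (lam b c) := by
    rw [cmul_mul, lam_eq a (lam b c)]; group
  rw [lam_eq (cmul a b), cmul_assoc, cmul_eq_mul_lam b c, h, inv_mul_cancel_left]

theorem one_lam (a : A) : lam 1 a = a := by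
  have h : cmul 1 a = a := ident_cmul a
  rw [lam_eq, h]; group

theorem lam_cinv_lam (a b : A) : lam (cinv a) (lam a b) = b := by
  rw [← lam_cmul, cinv_cmul]; exact one_lam b

theorem lam_lam_cinv (a b : A) : lam a (lam (cinv a) b) = b := by
  rw [← lam_cmul, cmul_cinv]; exact one_lam b

theorem cinv_eq (a : A) : cinv a = lam (cinv a) a⁻¹ := by
  have h : cinv a * lam (cinv a) a = 1 := by
    rw [← cmul_eq_mul_lam]; exact cinv_cmul a
  rw [lam_inv]; exact eq_inv_of_mul_eq_one_left h

theorem mul_eq_cmul (a b : A) : a * b = cmul a (lam (cinv a) b) := by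
  rw [cmul_eq_mul_lam, lam_lam_cinv]

theorem bstar_eq_one_iff (a b : A) : bstar a b = 1 ↔ lam a b = b := by
  rw [bstar_eq, mul_inv_eq_one]

theorem dcomm_eq_one_iff (a b : A) : dcomm a b = 1 ↔ a * b = b * a := by
  rw [dcomm_eq, mul_inv_eq_one, mul_inv_eq_iff_eq_mul]

theorem bstar_one (a : A) : bstar a 1 = 1 := (bstar_eq_one_iff _ _).2 (lam_one a)

theorem one_mem_AnnS (n : ℕ) : (1 : A) ∈ AnnS A n := by
  induction n with
  | zero => exact rfl
  | succ n ih =>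
    intro b
    rw [(bstar_eq_one_iff 1 b).2 (one_lam b), bstar_one,
      (dcomm_eq_one_iff 1 b).2 (by simp)]
    exact ⟨ih, ih, ih⟩

/-! ### The annihilator -/

theorem lam_of_mem_AnnS_one {z : A} (hz : z ∈ AnnS A 1) (b : A) : lam z b = b :=
  (bstar_eq_one_iff _ _).1 (hz b).1

theorem lam_fix_of_mem_AnnS_one {z : A} (hz : z ∈ AnnS A 1) (b : A) : lam b z = z :=
  (bstar_eq_one_iff _ _).1 (hz b).2.1

theorem commute_of_mem_AnnS_one {z : A} (hz : z ∈ AnnS A 1) (b : A) : Commute z b :=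
  (dcomm_eq_one_iff _ _).1 (hz b).2.2

theorem lam_mul_of_mem_AnnS_one {z : A} (hz : z ∈ AnnS A 1) (a b : A) :
    lam (z * a) b = lam a b := by
  rw [mul_eq_cmul, lam_cmul, lam_of_mem_AnnS_one hz]
  congr 1
  rw [← lam_of_mem_AnnS_one hz (lam (cinv z) a), lam_lam_cinv]

theorem mul_conj_of_mem_AnnS_one {z : A} (hz : z ∈ AnnS A 1) (a b : A) :
    z * a * b * (z * a)⁻¹ = a * b * a⁻¹ := by
  have h := (commute_of_mem_AnnS_one hz (a * b * a⁻¹)).eq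
  calc z * a * b * (z * a)⁻¹ = z * (a * b * a⁻¹) * z⁻¹ := by group
    _ = a * b * a⁻¹ := by rw [h]; group

theorem mul_mul_mul_inv_of_mem_AnnS_one {z : A} (hz : z ∈ AnnS A 1) (a b : A) :
    z * a * (z * b)⁻¹ = a * b⁻¹ := by
  have h := (commute_of_mem_AnnS_one hz (a * b⁻¹)).eq
  calc z * a * (z * b)⁻¹ = z * (a * b⁻¹) * z⁻¹ := by group
    _ = a * b⁻¹ := by rw [h]; group

theorem dcomm_mul_left_of_mem_AnnS_one {z : A} (hz : z ∈ AnnS A 1) (a b : A) :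
    dcomm (z * a) b = dcomm a b := by
  rw [dcomm_eq, dcomm_eq, mul_conj_of_mem_AnnS_one hz]

theorem dcomm_mul_right_of_mem_AnnS_one {z : A} (hz : z ∈ AnnS A 1) (a b : A) :
    dcomm a (z * b) = dcomm a b := by
  have h := (commute_of_mem_AnnS_one hz a).eq
  calc dcomm a (z * b) = a * z * (b * a⁻¹) * (z * b)⁻¹ := by rw [dcomm_eq]; group
    _ = z * (a * (b * a⁻¹)) * (z * b)⁻¹ := by rw [← h, mul_assoc z]
    _ = dcomm a b := by rw [mul_mul_mul_inv_of_mem_AnnS_one hz, dcomm_eq]; group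

theorem bstar_mul_left_of_mem_AnnS_one {z : A} (hz : z ∈ AnnS A 1) (a b : A) :
    bstar (z * a) b = bstar a b := by
  rw [bstar_eq, bstar_eq, lam_mul_of_mem_AnnS_one hz]

theorem bstar_mul_right_of_mem_AnnS_one {z : A} (hz : z ∈ AnnS A 1) (a b : A) :
    bstar a (z * b) = bstar a b := by
  rw [bstar_eq, bstar_eq, lam_mul, lam_fix_of_mem_AnnS_one hz,
    mul_mul_mul_inv_of_mem_AnnS_one hz]

theorem evalX_mul_right_of_mem_AnnS_one {z : A} (hz : z ∈ AnnS A 1) (e : BWord) (a b : A) :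
    evalX e a (z * b) = evalX e a b := by
  cases e
  · exact dcomm_mul_right_of_mem_AnnS_one hz a b
  · exact dcomm_mul_left_of_mem_AnnS_one hz b a
  · exact bstar_mul_right_of_mem_AnnS_one hz a b
  · exact bstar_mul_left_of_mem_AnnS_one hz b a

/-! ### The second annihilator -/

theorem exists_lam_eq_mul {x : A} (hx : x ∈ AnnS A 2) (b : A) :
    ∃ z ∈ AnnS A 1, lam x b = z * b :=
  ⟨bstar x b, (hx b).1, by rw [bstar_eq]; group⟩

theorem exists_lam_fix_eq_mul {x : A} (hx : x ∈ AnnS A 2) (b : A) :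
    ∃ z ∈ AnnS A 1, lam b x = z * x :=
  ⟨bstar b x, (hx b).2.1, by rw [bstar_eq]; group⟩

theorem exists_conj_eq_mul {x : A} (hx : x ∈ AnnS A 2) (b : A) :
    ∃ z ∈ AnnS A 1, x * b * x⁻¹ = z * b :=
  ⟨dcomm x b, (hx b).2.2, by rw [dcomm_eq]; group⟩

theorem lam_mul_of_mem_AnnS_two {x : A} (hx : x ∈ AnnS A 2) (a b : A) :
    lam (x * a) b = lam x (lam a b) := by
  obtain ⟨z, hz, h⟩ := exists_lam_eq_mul hx a
  rw [← lam_cmul, cmul_eq_mul_lam, h, ← mul_assoc, ← (commute_of_mem_AnnS_one hz x).eq,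
    mul_assoc, lam_mul_of_mem_AnnS_one hz]

theorem lam_mul_of_mem_AnnS_two' {x : A} (hx : x ∈ AnnS A 2) (a b : A) :
    lam (x * a) b = lam a (lam x b) := by
  obtain ⟨z, hz, h⟩ := exists_lam_fix_eq_mul hx a
  obtain ⟨w, hw, h'⟩ := exists_conj_eq_mul hx a
  have h'' : x * a = w * (a * x) := by rw [← mul_assoc, ← h']; group
  rw [← lam_cmul, cmul_eq_mul_lam, h, ← mul_assoc, ← (commute_of_mem_AnnS_one hz a).eq,
    mul_assoc, lam_mul_of_mem_AnnS_one hz, h'', lam_mul_of_mem_AnnS_one hw]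

theorem lam_bstar_of_mem_AnnS_two {x : A} (hx : x ∈ AnnS A 2) (a b : A) :
    lam x (bstar a b) = bstar a b := by
  obtain ⟨z, hz, h⟩ := exists_lam_eq_mul hx b
  rw [bstar_eq, lam_mul, ← lam_mul_of_mem_AnnS_two hx, lam_mul_of_mem_AnnS_two' hx, lam_inv, h,
    lam_mul, lam_fix_of_mem_AnnS_one hz, mul_mul_mul_inv_of_mem_AnnS_one hz]

theorem lam_dcomm (c a b : A) : lam c (dcomm a b) = dcomm (lam c a) (lam c b) := by
  simp only [dcomm_eq, lam_mul, lam_inv]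

theorem lam_bstar (c a b : A) :
    lam c (bstar a b) = bstar (cmul (cmul c a) (cinv c)) (lam c b) := by
  rw [bstar_eq, bstar_eq, lam_mul, lam_inv, lam_cmul, lam_cinv_lam, lam_cmul]

theorem lam_dcomm_of_mem_AnnS_two {x : A} (hx : x ∈ AnnS A 2) (a b : A) :
    lam x (dcomm a b) = dcomm a b := by
  obtain ⟨z, hz, h⟩ := exists_lam_eq_mul hx a
  obtain ⟨w, hw, h'⟩ := exists_lam_eq_mul hx b
  rw [lam_dcomm, h, h', dcomm_mul_left_of_mem_AnnS_one hz, dcomm_mul_right_of_mem_AnnS_one hw]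

theorem commute_dcomm_of_mem_AnnS_two {x : A} (hx : x ∈ AnnS A 2) (a b : A) :
    Commute x (dcomm a b) := by
  obtain ⟨z, hz, h⟩ := exists_conj_eq_mul hx a
  obtain ⟨w, hw, h'⟩ := exists_conj_eq_mul hx b
  have hc : x * dcomm a b * x⁻¹ = dcomm (x * a * x⁻¹) (x * b * x⁻¹) := by
    simp only [dcomm_eq]; group
  rw [h, h', dcomm_mul_left_of_mem_AnnS_one hz, dcomm_mul_right_of_mem_AnnS_one hw] at hc
  exact mul_inv_eq_iff_eq_mul.1 hc

theorem commute_bstar_of_mem_AnnS_two {x : A} (hx : x ∈ AnnS A 2) (a b : A) :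
    Commute x (bstar a b) := by
  obtain ⟨z, hz, h⟩ := exists_conj_eq_mul hx b
  obtain ⟨w, hw, h'⟩ := exists_lam_fix_eq_mul hx a
  have hc := congrArg (lam a) h
  rw [lam_mul, lam_mul, lam_mul, lam_inv, h', mul_conj_of_mem_AnnS_one hw,
    lam_fix_of_mem_AnnS_one hz] at hc
  refine mul_inv_eq_iff_eq_mul.1 ?_
  calc x * bstar a b * x⁻¹ = x * lam a b * x⁻¹ * (x * b * x⁻¹)⁻¹ := by rw [bstar_eq]; group
    _ = bstar a b := by rw [hc, h, mul_mul_mul_inv_of_mem_AnnS_one hz, bstar_eq]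

theorem exists_dcomm_mul_left {x : A} (hx : x ∈ AnnS A 2) (a b : A) :
    ∃ z ∈ AnnS A 1, dcomm (x * a) b = z * dcomm a b := by
  refine ⟨dcomm x b, (hx b).2.2, ?_⟩
  rw [(commute_of_mem_AnnS_one (hx b).2.2 _).eq]
  calc dcomm (x * a) b = x * dcomm a b * (b * x⁻¹ * b⁻¹) := by simp only [dcomm_eq]; group
    _ = dcomm a b * dcomm x b := by
      rw [(commute_dcomm_of_mem_AnnS_two hx a b).eq, dcomm_eq x b]; group

theorem exists_dcomm_mul_right {x : A} (hx : x ∈ AnnS A 2) (a b : A) :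
    ∃ z ∈ AnnS A 1, dcomm a (x * b) = z * dcomm a b := by
  have hc := (hx a⁻¹).2.2
  have ha : a * dcomm x a⁻¹ * a⁻¹ = dcomm x a⁻¹ := by
    rw [← (commute_of_mem_AnnS_one hc a).eq]; group
  refine ⟨dcomm x a⁻¹, hc, ?_⟩
  calc dcomm a (x * b) = a * dcomm x a⁻¹ * a⁻¹ * (x * dcomm a b * x⁻¹) := by
        simp only [dcomm_eq]; group
    _ = dcomm x a⁻¹ * dcomm a b := by
      rw [(commute_dcomm_of_mem_AnnS_two hx a b).eq, ha]; group

theorem exists_bstar_mul_left {x : A} (hx : x ∈ AnnS A 2) (a b : A) :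
    ∃ z ∈ AnnS A 1, bstar (x * a) b = z * bstar a b := by
  obtain ⟨z, hz, h⟩ := exists_lam_eq_mul hx (lam a b)
  exact ⟨z, hz, by rw [bstar_eq, lam_mul_of_mem_AnnS_two hx, h, bstar_eq, mul_assoc]⟩

theorem exists_bstar_mul_right {x : A} (hx : x ∈ AnnS A 2) (a b : A) :
    ∃ z ∈ AnnS A 1, bstar a (x * b) = z * bstar a b := by
  obtain ⟨z, hz, h⟩ := exists_lam_fix_eq_mul hx a
  refine ⟨z, hz, ?_⟩
  calc bstar a (x * b) = z * (x * bstar a b) * x⁻¹ := by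
        simp only [bstar_eq, lam_mul, h]; group
    _ = z * bstar a b := by rw [(commute_bstar_of_mem_AnnS_two hx a b).eq]; group

theorem exists_evalX_mul_left {x : A} (hx : x ∈ AnnS A 2) (e : BWord) (a b : A) :
    ∃ z ∈ AnnS A 1, evalX e (x * a) b = z * evalX e a b := by
  cases e
  · exact exists_dcomm_mul_left hx a b
  · exact exists_dcomm_mul_right hx b a
  · exact exists_bstar_mul_left hx a b
  · exact exists_bstar_mul_right hx b a

theorem exists_evalX_mul_right {x : A} (hx : x ∈ AnnS A 2) (e : BWord) (a b : A) :
    ∃ z ∈ AnnS A 1, evalX e a (x * b) = z * evalX e a b := by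
  cases e
  · exact exists_dcomm_mul_right hx a b
  · exact exists_dcomm_mul_left hx b a
  · exact exists_bstar_mul_right hx a b
  · exact exists_bstar_mul_left hx b a

theorem lam_evalX_of_mem_AnnS_two {x : A} (hx : x ∈ AnnS A 2) (e : BWord) (a b : A) :
    lam x (evalX e a b) = evalX e a b := by
  cases e
  · exact lam_dcomm_of_mem_AnnS_two hx a b
  · exact lam_dcomm_of_mem_AnnS_two hx b a
  · exact lam_bstar_of_mem_AnnS_two hx a b
  · exact lam_bstar_of_mem_AnnS_two hx b a

theorem commute_evalX_of_mem_AnnS_two {x : A} (hx : x ∈ AnnS A 2) (e : BWord) (a b : A) :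
    Commute x (evalX e a b) := by
  cases e
  · exact commute_dcomm_of_mem_AnnS_two hx a b
  · exact commute_dcomm_of_mem_AnnS_two hx b a
  · exact commute_bstar_of_mem_AnnS_two hx a b
  · exact commute_bstar_of_mem_AnnS_two hx b a

theorem evalX_mem_Gamma_two (e : BWord) (a b : A) : evalX e a b ∈ Gamma A 2 := by
  refine dclosure.mem ?_
  cases e
  · exact Or.inr ⟨a, trivial, b, trivial, rfl⟩
  · exact Or.inr ⟨b, trivial, a, trivial, rfl⟩
  · exact Or.inl (Or.inl ⟨a, trivial, b, trivial, rfl⟩)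
  · exact Or.inl (Or.inl ⟨b, trivial, a, trivial, rfl⟩)

/-- An element that centralises `x` and is fixed by `λ_x`, and whose own `λ` fixes `x`, does not
see a factor `x ∈ Ann₂(A)` in the other argument of a brace commutator. -/
theorem evalX_mul_left_eq {x p : A} (hx : x ∈ AnnS A 2) (hlam : lam x p = p)
    (hcomm : Commute x p) (hfix : lam p x = x) (e : BWord) (a : A) :
    evalX e (x * a) p = evalX e a p := by
  have hd : dcomm (x * a) p = dcomm a p := by
    calc dcomm (x * a) p = x * dcomm a p * (p * x⁻¹ * p⁻¹) := by simp only [dcomm_eq]; group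
      _ = dcomm a p := by
        rw [(commute_dcomm_of_mem_AnnS_two hx a p).eq, ← hcomm.inv_left.eq]; group
  cases e
  · exact hd
  · have hi : ∀ c d : A, dcomm c d = (dcomm d c)⁻¹ := fun c d => by simp only [dcomm_eq]; group
    exact (hi _ _).trans ((congrArg _ hd).trans (hi _ _).symm)
  · change bstar (x * a) p = bstar a p
    rw [bstar_eq, lam_mul_of_mem_AnnS_two' hx, hlam, bstar_eq]
  · change bstar p (x * a) = bstar p a
    calc bstar p (x * a) = x * bstar p a * x⁻¹ := by
          simp only [bstar_eq, lam_mul, hfix]; group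
      _ = bstar p a := by rw [(commute_bstar_of_mem_AnnS_two hx p a).eq]; group

/-! ### Action of `Γ₂(A)` -/

theorem lam_cinv_eq_self {a x : A} (h : lam a x = x) : lam (cinv a) x = x := by
  conv_lhs => rw [← h]
  exact lam_cinv_lam a x

theorem cinv_cinv (a : A) : cinv (cinv a) = a := by
  rw [← cmul_ident (cinv (cinv a)), ← cinv_cmul a, ← cmul_assoc, cinv_cmul, ident_cmul]

/-- If the values of `*` and of the dot commutator act trivially on `x` through `λ`,
then so do all elements of `Γ₂(A)`. -/
theorem lam_eq_self_of_mem_Gamma_two {x v : A} (hs : ∀ a b : A, lam (bstar a b) x = x)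
    (hd : ∀ a b : A, lam (dcomm a b) x = x) (hv : v ∈ Gamma A 2) : lam v x = x := by
  suffices h : ∀ c : A, lam (lam c v) x = x by simpa [one_lam] using h 1
  change dclosure _ v at hv
  induction hv with
  | mem h =>
    intro c
    rcases h with (⟨a, -, b, -, rfl⟩ | ⟨a, -, b, -, rfl⟩) | ⟨a, -, b, -, rfl⟩
    · rw [lam_bstar]; exact hs _ _
    · rw [lam_bstar]; exact hs _ _
    · rw [lam_dcomm]; exact hd _ _
  | one =>
    intro c
    exact (congrArg (fun y => lam y x) (lam_one c)).trans (one_lam x)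
  | @mul v w _ _ ihv ihw =>
    intro c
    change lam (lam c (v * w)) x = x
    rw [lam_mul, mul_eq_cmul, lam_cmul, ← lam_cmul _ c w, ihw, ihv]
  | @inv v _ ih =>
    intro c
    change lam (lam c v⁻¹) x = x
    rw [← cinv_cinv (lam c v⁻¹)]
    apply lam_cinv_eq_self
    rw [cinv_eq, lam_inv c, inv_inv, ← lam_cmul]
    exact ih _

theorem bstar_eq_one_of_inClass_two (h : InClass A 2) {x v : A} (hx : x ∈ AnnS A 2)
    (hv : v ∈ Gamma A 2) : bstar v x = 1 := by
  have key : ∀ (e : BWord) (a b : A), lam (evalX e a b) x = x := by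
    intro e a b
    have h' := h (fun i => if i = 0 then .sbar else e)
      (fun i => if i = 0 then 1 else if i = 1 then a else b)
      (fun i => if i = 0 then x * 1 else if i = 1 then a else b) (by
        intro i _
        by_cases hi : i = 0
        · exact ⟨x, hx, by simp only [hi, if_true]; rfl⟩
        · exact ⟨1, one_mem_AnnS 2, by simp only [hi, if_false]; exact (ident_dmul _).symm⟩)
    have h'' : bstar (evalX e a b) (x * 1) = bstar (evalX e a b) 1 := h'
    rwa [bstar_one, mul_one, bstar_eq_one_iff] at h''
  exact (bstar_eq_one_iff v x).2
    (lam_eq_self_of_mem_Gamma_two (key .s) (key .g) hv)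

theorem inClass_two_of_bstar_eq_one
    (h : ∀ x ∈ AnnS A 2, ∀ v ∈ Gamma A 2, bstar v x = 1) : InClass A 2 := by
  intro e a b hab
  obtain ⟨x, hx, hx0⟩ := hab 0 (by norm_num)
  obtain ⟨y, hy, hy1⟩ := hab 1 (by norm_num)
  obtain ⟨w, hw, hw2⟩ := hab 2 (by norm_num)
  change evalX (e 0) (b 0) (evalX (e 1) (b 1) (b 2)) =
    evalX (e 0) (a 0) (evalX (e 1) (a 1) (a 2))
  rw [hx0, hy1, hw2]
  obtain ⟨z, hz, h1⟩ := exists_evalX_mul_left hy (e 1) (a 1) (w * a 2)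
  obtain ⟨z', hz', h2⟩ := exists_evalX_mul_right hw (e 1) (a 1) (a 2)
  change evalX (e 0) (x * a 0) (evalX (e 1) (y * a 1) (w * a 2)) = _
  rw [h1, evalX_mul_right_of_mem_AnnS_one hz, h2, evalX_mul_right_of_mem_AnnS_one hz']
  exact evalX_mul_left_eq hx (lam_evalX_of_mem_AnnS_two hx _ _ _)
    (commute_evalX_of_mem_AnnS_two hx _ _ _)
    ((bstar_eq_one_iff _ _).1 (h x hx _ (evalX_mem_Gamma_two _ _ _))) _ _

end

end SkewBrace

open SkewBrace in
/-- A skew left brace `A` belongs to the class `I₂` if and only if `v * x = 1` for all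
`x ∈ Ann₂(A)` and all `v ∈ Γ₂(A)`. -/
theorem inClass_two_iff (A : Type u) [SkewBrace A] :
    InClass A 2 ↔ ∀ x ∈ AnnS A 2, ∀ v ∈ Gamma A 2, bstar v x = ident :=
  ⟨fun h _ hx _ hv => bstar_eq_one_of_inClass_two h hx hv, inClass_two_of_bstar_eq_one⟩
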